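/- Let p ∈ [1,∞) and c > 1. Let ℓ̄ : ℝ → ℝ be one of: ℓ₁(x) = (x−m)₊ for some m ∈ ℝ; ℓ₃(x) = (|x−m₁|−m₂)₊ for some m₁ ∈ ℝ and m₂ ≥ 0; ℓ₄(x) = |x−m| + b for some m ∈ ℝ and b > 0; and set ℓ(z,t) = c·ℓ̄(z−t), or alternatively set ℓ(z,t) = c·(|z|−t)₊. Define, for a distribution F on ℝⁿ with finite p-th moment and β ∈ ℝⁿ, ρ^F(β^⊤Z) = inf_{t∈ℝ} { t + (E^F[ℓ(β^⊤Z, t)^p])^{1/p} }. Then for every Borel probability distribution F₀ on ℝⁿ with finite p-th moment, every ε ≥ 0, and every D ⊆ ℝⁿ: inf_{β∈D} sup_{F∈B_p(F₀,ε)} ρ^F(β^⊤Z) = inf_{β∈D} { ρ^{F₀}(β^⊤Z) + cε‖β‖_* }. -/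

import Mathlib

open MeasureTheory Set
open scoped ENNReal NNReal

noncomputable section

abbrev Vec (n : ℕ) := Fin n → ℝ

/-- `β^⊤x` -/
def dotp {n : ℕ} (β x : Vec n) : ℝ := ∑ i, β i * x i

/-- `nrm` is a norm on `ℝⁿ`. -/
def IsNorm {n : ℕ} (nrm : Vec n → ℝ) : Prop :=
  (∀ x, nrm x = 0 ↔ x = 0) ∧
  (∀ (c : ℝ) (x : Vec n), nrm (c • x) = |c| * nrm x) ∧
  (∀ x y : Vec n, nrm (x + y) ≤ nrm x + nrm y)

/-- the dual norm `‖β‖_* = sup_{‖x‖ ≤ 1} β^⊤x`. -/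
def dualNorm {n : ℕ} (nrm : Vec n → ℝ) (β : Vec n) : ℝ :=
  sSup {r | ∃ x, nrm x ≤ 1 ∧ r = dotp β x}

/-- Couplings of two probability measures. -/
def Couplings {E : Type*} [MeasurableSpace E] (μ ν : Measure E) : Set (Measure (E × E)) :=
  {π | IsProbabilityMeasure π ∧ π.map Prod.fst = μ ∧ π.map Prod.snd = ν}

/-- The type-`p` Wasserstein distance (valued in `ℝ≥0∞`) associated with an
extended-real-valued cost; for `p = ∞` it is the infimum over couplings of the essential
supremum of the cost. -/
def WassersteinD {E : Type*} [MeasurableSpace E] (cost : E → E → ℝ≥0∞) (p : ℝ≥0∞)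
    (μ ν : Measure E) : ℝ≥0∞ :=
  if p = ∞ then ⨅ π ∈ Couplings μ ν, essSup (fun z : E × E => cost z.1 z.2) π
  else ⨅ π ∈ Couplings μ ν, (∫⁻ z, cost z.1 z.2 ^ p.toReal ∂π) ^ (1 / p.toReal)

/-- Finite `p`-th moment (with respect to a "norm-like" function `nrm`);
for `p = ∞` it means essential boundedness. -/
def HasMomentP {E : Type*} [MeasurableSpace E] (nrm : E → ℝ) (p : ℝ≥0∞) (μ : Measure E) : Prop :=
  if p = ∞ then essSup (fun x => ENNReal.ofReal (nrm x)) μ ≠ ∞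
  else ∫⁻ x, ENNReal.ofReal (nrm x) ^ p.toReal ∂μ ≠ ∞

/-- The type-`p` Wasserstein ball of probability distributions on `ℝⁿ` (norm `nrm`). -/
def WballVec {n : ℕ} (nrm : Vec n → ℝ) (p : ℝ≥0∞) (μ₀ : Measure (Vec n)) (ε : ℝ) :
    Set (Measure (Vec n)) :=
  {μ | IsProbabilityMeasure μ ∧ HasMomentP nrm p μ ∧
    WassersteinD (fun x y => ENNReal.ofReal (nrm (x - y))) p μ μ₀ ≤ ENNReal.ofReal ε}

/-- The type-`p` Wasserstein ball of probability distributions on `ℝ`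
(absolute-value norm). -/
def WballReal (p : ℝ≥0∞) (μ₀ : Measure ℝ) (ε : ℝ) : Set (Measure ℝ) :=
  {μ | IsProbabilityMeasure μ ∧ HasMomentP (fun x : ℝ => |x|) p μ ∧
    WassersteinD (fun x y : ℝ => ENNReal.ofReal |x - y|) p μ μ₀ ≤ ENNReal.ofReal ε}

/-- The metric on `Ξ = {-1,1} × ℝⁿ`:
`d((y₁,x₁),(y₂,x₂)) = ‖x₁ - x₂‖` if `y₁ = y₂`, and `+∞` otherwise. -/
def xiCost {n : ℕ} (nrm : Vec n → ℝ) (z₁ z₂ : ℝ × Vec n) : ℝ≥0∞ :=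
  if z₁.1 = z₂.1 then ENNReal.ofReal (nrm (z₁.2 - z₂.2)) else ∞

/-- A measure on `ℝ × ℝⁿ` is concentrated on `Ξ = {-1,1} × ℝⁿ`. -/
def OnXi {n : ℕ} (μ : Measure (ℝ × Vec n)) : Prop :=
  μ {z | z.1 = 1 ∨ z.1 = -1} = 1

/-- The type-`p` Wasserstein ball `B̄_p(F₀,ε)` of probability distributions on
`Ξ = {-1,1} × ℝⁿ`. -/
def WballXi {n : ℕ} (nrm : Vec n → ℝ) (p : ℝ≥0∞) (μ₀ : Measure (ℝ × Vec n)) (ε : ℝ) :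
    Set (Measure (ℝ × Vec n)) :=
  {μ | IsProbabilityMeasure μ ∧ OnXi μ ∧ HasMomentP (fun z => nrm z.2) p μ ∧
    WassersteinD (xiCost nrm) p μ μ₀ ≤ ENNReal.ofReal ε}

/-- The risk measure `ρ^F(β^⊤Z) = inf_t { t + (E^F[ℓ(β^⊤Z,t)^p])^{1/p} }`. -/
def rhoInfT {n : ℕ} (ℓ : ℝ → ℝ → ℝ) (p : ℝ) (F : Measure (Vec n)) (β : Vec n) : ℝ :=
  sInf {r | ∃ t : ℝ, r = t + (∫ x, ℓ (dotp β x) t ^ p ∂F) ^ (1 / p)}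

/-- One-dimensional minimax principle for a family of convex continuous functions that is
closed under domination of convex combinations. -/
theorem exists_forall_lt_of_concavelike {ι : Type*} {J : ι → ℝ → ℝ}
    (hconv : ∀ i, ConvexOn ℝ univ (J i)) (hcont : ∀ i, Continuous (J i))
    (hmix : ∀ i j (a b : ℝ), 0 ≤ a → 0 ≤ b → a + b = 1 → ∃ k, ∀ t, a * J i t + b * J j t ≤ J k t)
    {K : Set ℝ} (hne : K.Nonempty) (hK : Convex ℝ K) (hcK : IsCompact K) {v v' : ℝ} (hv : v < v')
    (hlt : ∀ t ∈ K, ∃ i, v' < J i t) : ∃ i, ∀ t ∈ K, v < J i t := by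
  let Y : Set (ℝ → ℝ) := {G | ConvexOn ℝ univ G ∧ Continuous G ∧ ∃ i, ∀ t, G t ≤ J i t}
  have hY : Convex ℝ Y := by
    rintro G ⟨hG, hGc, i, hi⟩ H ⟨hH, hHc, j, hj⟩ a b ha hb hab
    obtain ⟨k, hk⟩ := hmix i j a b ha hb hab
    refine ⟨(hG.smul ha).add (hH.smul hb), (hGc.const_smul a).add (hHc.const_smul b), k,
      fun t => le_trans ?_ (hk t)⟩
    simp only [Pi.add_apply, Pi.smul_apply, smul_eq_mul]
    gcongr
    exacts [hi t, hj t]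
  have hcoe : Monotone ((↑) : ℝ → EReal) := EReal.coe_strictMono.monotone
  have hmm := Sion.minimax' (X := K) (Y := Y) (f := fun t G => ((G t : ℝ) : EReal)) hne hK hcK
    (fun G hG => (continuous_coe_real_ereal.comp hG.2.1).continuousOn.lowerSemicontinuousOn)
    (fun G hG => QuasiconvexOn.monotone_comp (f := G) hcoe
      (hG.1.subset (subset_univ K) hK).quasiconvexOn)
    hY
    (fun t _ => (continuous_coe_real_ereal.comp
      (continuous_apply t)).continuousOn.upperSemicontinuousOn)
    (fun t _ => by
      have hlin : ConcaveOn ℝ Y fun G : ℝ → ℝ => G t := ⟨hY, fun G _ H _ a b _ _ _ => le_rfl⟩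
      exact QuasiconcaveOn.monotone_comp (f := fun G : ℝ → ℝ => G t) hcoe hlin.quasiconcaveOn)
  have h1 : (v' : EReal) ≤ ⨅ t ∈ K, ⨆ G ∈ Y, ((G t : ℝ) : EReal) := by
    refine le_iInf₂ fun t ht => ?_
    obtain ⟨i, hi⟩ := hlt t ht
    exact le_iSup₂_of_le (J i) ⟨hconv i, hcont i, i, fun _ => le_rfl⟩ (hcoe hi.le)
  have h2 : (v : EReal) < ⨆ G ∈ Y, ⨅ t ∈ K, ((G t : ℝ) : EReal) :=
    (EReal.coe_lt_coe_iff.2 hv).trans_le (h1.trans hmm.le)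
  simp only [lt_iSup_iff] at h2
  obtain ⟨G, ⟨-, -, i, hi⟩, hG⟩ := h2
  exact ⟨i, fun t ht => (EReal.coe_lt_coe_iff.1 (hG.trans_le (iInf₂_le t ht))).trans_le (hi t)⟩

section Norm

variable {n : ℕ} {nrm : Vec n → ℝ}

theorem dotp_add (β x y : Vec n) : dotp β (x + y) = dotp β x + dotp β y := by
  simp [dotp, mul_add, Finset.sum_add_distrib]

theorem dotp_smul (β : Vec n) (a : ℝ) (x : Vec n) : dotp β (a • x) = a * dotp β x := by
  simp only [dotp, Pi.smul_apply, smul_eq_mul, Finset.mul_sum]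
  exact Finset.sum_congr rfl fun i _ => by ring

theorem dotp_sub (β x y : Vec n) : dotp β (x - y) = dotp β x - dotp β y := by
  simp [dotp, mul_sub, Finset.sum_sub_distrib]

theorem continuous_dotp (β : Vec n) : Continuous (dotp β) := by
  unfold dotp
  fun_prop

theorem IsNorm.map_zero (h : IsNorm nrm) : nrm 0 = 0 := (h.1 0).2 rfl

theorem IsNorm.map_neg (h : IsNorm nrm) (x : Vec n) : nrm (-x) = nrm x := by
  simpa using h.2.1 (-1) x

theorem IsNorm.nonneg (h : IsNorm nrm) (x : Vec n) : 0 ≤ nrm x := by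
  have := h.2.2 x (-x)
  rw [add_neg_cancel, h.map_zero, h.map_neg] at this
  linarith

theorem IsNorm.le_mul_norm (h : IsNorm nrm) (x : Vec n) :
    nrm x ≤ (∑ i, nrm (Pi.single i 1)) * ‖x‖ := by
  have hsub : ∀ (s : Finset (Fin n)) (f : Fin n → Vec n), nrm (∑ i ∈ s, f i) ≤ ∑ i ∈ s, nrm (f i) :=
    fun s f => Finset.le_sum_of_subadditive nrm h.map_zero.le h.2.2 s f
  calc nrm x = nrm (∑ i, x i • (Pi.single i 1 : Vec n)) := by
        congr 1
        ext j
        simp [Finset.sum_apply, Pi.single_apply]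
    _ ≤ ∑ i, nrm (x i • (Pi.single i 1 : Vec n)) := hsub _ _
    _ ≤ ∑ i, nrm (Pi.single i 1) * ‖x‖ := by
        refine Finset.sum_le_sum fun i _ => ?_
        rw [h.2.1, mul_comm]
        exact mul_le_mul_of_nonneg_left (norm_le_pi_norm x i) (h.nonneg _)
    _ = _ := by rw [Finset.sum_mul]

theorem IsNorm.continuous (h : IsNorm nrm) : Continuous nrm := by
  have hC : 0 ≤ ∑ i, nrm (Pi.single i 1) := Finset.sum_nonneg fun i _ => h.nonneg _
  refine (LipschitzWith.of_dist_le_mul (K := ⟨_, hC⟩) fun x y => ?_).continuous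
  have key : ∀ x y : Vec n, nrm x - nrm y ≤ (∑ i, nrm (Pi.single i 1)) * ‖x - y‖ := fun x y => by
    have h1 := h.2.2 (x - y) y
    rw [sub_add_cancel] at h1
    linarith [h.le_mul_norm (x - y)]
  rw [Real.dist_eq, dist_eq_norm, abs_sub_le_iff]
  refine ⟨key x y, ?_⟩
  rw [norm_sub_rev]
  exact key y x

theorem IsNorm.exists_pos_mul_norm_le (h : IsNorm nrm) : ∃ κ > 0, ∀ x, κ * ‖x‖ ≤ nrm x := by
  obtain ⟨κ, hκ, hle⟩ := (isCompact_sphere (0 : Vec n) 1).exists_forall_le'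
    h.continuous.continuousOn (a := 0) fun x hx => (h.nonneg x).lt_of_ne fun h0 => by
      rw [(h.1 x).1 h0.symm] at hx
      simp at hx
  refine ⟨κ, hκ, fun x => ?_⟩
  rcases eq_or_ne x 0 with rfl | hx
  · simp [h.map_zero]
  have hx' : 0 < ‖x‖ := norm_pos_iff.2 hx
  have := hle (‖x‖⁻¹ • x) (by simp [norm_smul, hx'.ne'])
  rw [h.2.1, abs_of_pos (inv_pos.2 hx'), inv_mul_eq_div, le_div_iff₀ hx'] at this
  exact this

theorem IsNorm.isCompact_unitBall (h : IsNorm nrm) : IsCompact {x | nrm x ≤ 1} := by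
  obtain ⟨κ, hκ, hle⟩ := h.exists_pos_mul_norm_le
  refine (isCompact_closedBall (0 : Vec n) κ⁻¹).of_isClosed_subset
    (isClosed_le h.continuous continuous_const) fun x (hx : nrm x ≤ 1) => ?_
  rw [mem_closedBall_zero_iff, ← one_div, le_div_iff₀ hκ]
  linarith [hle x, mul_comm κ ‖x‖]

theorem IsNorm.exists_dualNorm_eq (h : IsNorm nrm) (β : Vec n) :
    ∃ u, nrm u ≤ 1 ∧ dotp β u = dualNorm nrm β ∧ ∀ x, nrm x ≤ 1 → dotp β x ≤ dotp β u := by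
  obtain ⟨u, hu, hmax⟩ := h.isCompact_unitBall.exists_isMaxOn ⟨0, by simp [h.map_zero]⟩
    (continuous_dotp β).continuousOn
  refine ⟨u, hu, ?_, fun x hx => hmax hx⟩
  have : IsGreatest {r | ∃ x, nrm x ≤ 1 ∧ r = dotp β x} (dotp β u) :=
    ⟨⟨u, hu, rfl⟩, by rintro _ ⟨x, hx, rfl⟩; exact hmax hx⟩
  exact this.csSup_eq.symm

theorem IsNorm.dualNorm_nonneg (h : IsNorm nrm) (β : Vec n) : 0 ≤ dualNorm nrm β := by
  obtain ⟨u, -, hd, hmax⟩ := h.exists_dualNorm_eq β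
  have := hmax 0 (by simp [h.map_zero])
  rw [← hd]
  simpa [dotp] using this

theorem IsNorm.abs_dotp_le (h : IsNorm nrm) (β x : Vec n) :
    |dotp β x| ≤ dualNorm nrm β * nrm x := by
  have key : ∀ x, dotp β x ≤ dualNorm nrm β * nrm x := fun x => by
    obtain ⟨u, -, hd, hmax⟩ := h.exists_dualNorm_eq β
    rcases (h.nonneg x).eq_or_lt with h0 | h0
    · rw [← h0, (h.1 x).1 h0.symm]
      simp [dotp]
    have := hmax ((nrm x)⁻¹ • x) (by
      rw [h.2.1, abs_of_pos (inv_pos.2 h0), inv_mul_cancel₀ h0.ne'])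
    rwa [dotp_smul, hd, inv_mul_eq_div, div_le_iff₀ h0] at this
  refine abs_le'.2 ⟨key x, ?_⟩
  have := key (-x)
  rw [h.map_neg] at this
  simpa [dotp] using this

end Norm

/-- The properties of the loss functions `ℓ(z,t)` on which exact regularization relies. -/
structure IsLoss (c : ℝ) (ℓ : ℝ → ℝ → ℝ) : Prop where
  nonneg : ∀ z t, 0 ≤ ℓ z t
  lip_left : ∀ z z' t, |ℓ z t - ℓ z' t| ≤ c * |z - z'|
  lip_right : ∀ z t t', |ℓ z t - ℓ z t'| ≤ c * |t - t'|
  convex : ∀ z, ConvexOn ℝ univ (ℓ z)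
  coercive : ∃ K, ∀ z t, c * (-t - K) ≤ ℓ z t + c * |z|
  growth : ∃ K, ∀ z w t, c * (w - |t| - K) ≤ ℓ (z + w) t + c * |z|
  aligned : ∀ t, ∃ s : ℝ → ℝ, Measurable s ∧ (∀ z, |s z| ≤ 1) ∧
    ∀ z v, 0 ≤ v → (ℓ z t = 0 → v = 0) → ℓ z t + c * v ≤ ℓ (z + s z * v) t

/-- The losses generated by translating a fixed convex `1`-Lipschitz profile. -/
theorem isLoss_of_profile {c : ℝ} (hc : 0 ≤ c) {f : ℝ → ℝ} (h0 : ∀ x, 0 ≤ f x)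
    (hlip : ∀ x y, |f x - f y| ≤ |x - y|) (hconv : ConvexOn ℝ univ f)
    (hgrow : ∃ K, ∀ x, x - K ≤ f x)
    (hal : ∃ s : ℝ → ℝ, Measurable s ∧ (∀ z, |s z| ≤ 1) ∧
      ∀ z v, 0 ≤ v → (f z = 0 → v = 0) → f z + v ≤ f (z + s z * v)) :
    IsLoss c (fun z t => c * f (z - t)) where
  nonneg z t := mul_nonneg hc (h0 _)
  lip_left z z' t := by
    rw [← mul_sub, abs_mul, abs_of_nonneg hc]
    exact mul_le_mul_of_nonneg_left (by simpa using hlip (z - t) (z' - t)) hc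
  lip_right z t t' := by
    rw [← mul_sub, abs_mul, abs_of_nonneg hc]
    exact mul_le_mul_of_nonneg_left (by simpa [abs_sub_comm] using hlip (z - t) (z - t')) hc
  convex z := by
    refine ⟨convex_univ, fun x _ y _ a b ha hb hab => ?_⟩
    have := hconv.2 (mem_univ (z - x)) (mem_univ (z - y)) ha hb hab
    simp only [smul_eq_mul] at this ⊢
    have e : z - (a * x + b * y) = a * (z - x) + b * (z - y) := by
      linear_combination (-z) * hab
    rw [e]
    nlinarith [mul_le_mul_of_nonneg_left this hc]
  coercive := by
    obtain ⟨K, hK⟩ := hgrow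
    refine ⟨K, fun z t => ?_⟩
    rw [← mul_add]
    gcongr
    linarith [hK (z - t), neg_abs_le z]
  growth := by
    obtain ⟨K, hK⟩ := hgrow
    refine ⟨K, fun z w t => ?_⟩
    rw [← mul_add]
    gcongr
    linarith [hK (z + w - t), neg_abs_le z, le_abs_self t]
  aligned t := by
    obtain ⟨s, hs, hs1, hsv⟩ := hal
    refine ⟨fun z => s (z - t), by fun_prop, fun z => hs1 _, fun z v hv hzv => ?_⟩
    rcases hc.eq_or_lt with rfl | hc'
    · simp
    have := hsv (z - t) v hv fun h => hzv (by simp [h])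
    rw [← mul_add, show z + s (z - t) * v - t = z - t + s (z - t) * v by ring]
    gcongr

theorem abs_max_zero_sub_max_zero_le (x y : ℝ) : |max x 0 - max y 0| ≤ |x - y| :=
  abs_max_sub_max_le_abs x y 0

theorem measurable_sign_ite (m : ℝ) : Measurable fun z : ℝ => if m ≤ z then (1 : ℝ) else -1 :=
  Measurable.ite measurableSet_Ici measurable_const measurable_const

theorem convexOn_abs_sub (m : ℝ) : ConvexOn ℝ univ fun x : ℝ => |x - m| := by
  refine ⟨convex_univ, fun x _ y _ a b ha hb hab => ?_⟩
  simp only [smul_eq_mul]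
  have e : a * x + b * y - m = a * (x - m) + b * (y - m) := by linear_combination m * hab
  rw [e]
  refine (abs_add_le _ _).trans ?_
  rw [abs_mul, abs_mul, abs_of_nonneg ha, abs_of_nonneg hb]

theorem abs_add_sign_ite (x m v : ℝ) (hv : 0 ≤ v) :
    |x + (if m ≤ x then (1 : ℝ) else -1) * v - m| = |x - m| + v := by
  split_ifs with h
  · rw [abs_of_nonneg, abs_of_nonneg] <;> linarith
  · rw [abs_of_neg, abs_of_neg] <;> linarith

theorem isLoss_posPart {c : ℝ} (hc : 0 ≤ c) (m : ℝ) :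
    IsLoss c (fun z t => c * max (z - t - m) 0) := by
  refine isLoss_of_profile (f := fun x => max (x - m) 0) hc (fun x => le_max_right _ _)
    (fun x y => (abs_max_zero_sub_max_zero_le _ _).trans (by simp)) ?_
    ⟨m, fun x => le_max_left _ _⟩
    ⟨fun _ => 1, measurable_const, by simp, fun z v hv hz => ?_⟩
  · exact ((convexOn_id convex_univ).sub (concaveOn_const m convex_univ)).sup
      (convexOn_const 0 convex_univ)
  · rcases le_total (z - m) 0 with h | h
    · rw [hz (max_eq_right h)]
      simp
    · rw [max_eq_left h]
      exact le_trans (by linarith) (le_max_left _ _)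

theorem isLoss_absPosPart {c : ℝ} (hc : 0 ≤ c) (m₁ m₂ : ℝ) :
    IsLoss c (fun z t => c * max (|z - t - m₁| - m₂) 0) := by
  refine isLoss_of_profile (f := fun x => max (|x - m₁| - m₂) 0) hc (fun x => le_max_right _ _)
    (fun x y => (abs_max_zero_sub_max_zero_le _ _).trans ?_) ?_
    ⟨m₁ + m₂, fun x => (by linarith [le_abs_self (x - m₁)] : _ ≤ |x - m₁| - m₂).trans
      (le_max_left _ _)⟩
    ⟨_, measurable_sign_ite m₁, fun z => by split_ifs <;> simp, fun z v hv hz => ?_⟩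
  · simpa using abs_abs_sub_abs_le_abs_sub (x - m₁) (y - m₁)
  · exact ((convexOn_abs_sub m₁).sub (concaveOn_const m₂ convex_univ)).sup
      (convexOn_const 0 convex_univ)
  · rcases le_total (|z - m₁| - m₂) 0 with h | h
    · rw [hz (max_eq_right h)]
      simp
    · rw [max_eq_left h, abs_add_sign_ite z m₁ v hv]
      exact le_trans (by linarith) (le_max_left _ _)

theorem isLoss_absAdd {c : ℝ} (hc : 0 ≤ c) (m : ℝ) {b : ℝ} (hb : 0 ≤ b) :
    IsLoss c (fun z t => c * (|z - t - m| + b)) := by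
  refine isLoss_of_profile (f := fun x => |x - m| + b) hc (fun x => by positivity)
    (fun x y => ?_) ?_ ⟨m, fun x => by linarith [le_abs_self (x - m)]⟩
    ⟨_, measurable_sign_ite m, fun z => by split_ifs <;> simp, fun z v hv _ => ?_⟩
  · simpa using abs_abs_sub_abs_le_abs_sub (x - m) (y - m)
  · exact (convexOn_abs_sub m).add_const b
  · rw [abs_add_sign_ite z m v hv]
    linarith

theorem isLoss_abs_sub {c : ℝ} (hc : 0 ≤ c) : IsLoss c (fun z t => c * max (|z| - t) 0) where
  nonneg z t := by positivity
  lip_left z z' t := by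
    rw [← mul_sub, abs_mul, abs_of_nonneg hc]
    exact mul_le_mul_of_nonneg_left ((abs_max_zero_sub_max_zero_le _ _).trans
      (by simpa using abs_abs_sub_abs_le_abs_sub z z')) hc
  lip_right z t t' := by
    rw [← mul_sub, abs_mul, abs_of_nonneg hc]
    exact mul_le_mul_of_nonneg_left ((abs_max_zero_sub_max_zero_le _ _).trans
      (by simp [abs_sub_comm])) hc
  convex z := by
    refine ConvexOn.smul hc (ConvexOn.sup ?_ (convexOn_const 0 convex_univ))
    exact (convexOn_const |z| convex_univ).sub (concaveOn_id convex_univ)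
  coercive := ⟨0, fun z t => by
    rw [← mul_add]
    gcongr
    linarith [le_max_left (|z| - t) 0, abs_nonneg z]⟩
  growth := ⟨0, fun z w t => by
    rw [← mul_add]
    gcongr
    linarith [le_max_left (|z + w| - t) 0, le_abs_self (z + w), le_abs_self t, neg_abs_le z]⟩
  aligned t := by
    refine ⟨_, measurable_sign_ite 0, fun z => by split_ifs <;> simp, fun z v hv hz => ?_⟩
    have key := abs_add_sign_ite z 0 v hv
    rw [sub_zero, sub_zero] at key
    rcases le_total (|z| - t) 0 with h | h
    · rw [hz (by simp [h])]
      simp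
    · rw [← mul_add, max_eq_left h, key]
      gcongr
      exact le_trans (by linarith) (le_max_left _ _)

section Lp

variable {α : Type*} [MeasurableSpace α] {μ : Measure α} {p : ℝ}

theorem lpNorm_le_add_of_abs_le {P : ℝ≥0∞} (hP : 1 ≤ P) {f g k : α → ℝ} (hg : MemLp g P μ)
    (hk : MemLp k P μ) (h : ∀ x, |f x| ≤ g x + k x) :
    lpNorm f P μ ≤ lpNorm g P μ + lpNorm k P μ :=
  (lpNorm_mono_real (hg.add hk) h).trans (lpNorm_add_le hg hP)

theorem lintegral_ofReal_rpow_eq (hp : 1 ≤ p) {f : α → ℝ} (hf : MemLp f (ENNReal.ofReal p) μ)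
    (h0 : ∀ x, 0 ≤ f x) :
    ∫⁻ x, ENNReal.ofReal (f x) ^ p ∂μ = ENNReal.ofReal (lpNorm f (ENNReal.ofReal p) μ) ^ p := by
  have hp0 : 0 < p := by linarith
  rw [ofReal_lpNorm hf, eLpNorm_eq_lintegral_rpow_enorm_toReal (by simpa using hp0) (by simp),
    ENNReal.toReal_ofReal hp0.le, ← ENNReal.rpow_mul, one_div, inv_mul_cancel₀ hp0.ne',
    ENNReal.rpow_one]
  simp_rw [Real.enorm_of_nonneg (h0 _)]

theorem memLp_of_lintegral_ofReal_rpow_lt_top (hp : 1 ≤ p) {f : α → ℝ}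
    (hf : AEStronglyMeasurable f μ) (h0 : ∀ x, 0 ≤ f x)
    (h : ∫⁻ x, ENNReal.ofReal (f x) ^ p ∂μ < ∞) : MemLp f (ENNReal.ofReal p) μ := by
  have hp0 : 0 < p := by linarith
  refine ⟨hf, (eLpNorm_lt_top_iff_lintegral_rpow_enorm_lt_top (by simpa using hp0) (by simp)).2 ?_⟩
  rw [ENNReal.toReal_ofReal hp0.le]
  simpa only [Real.enorm_of_nonneg (h0 _)] using h

theorem lpNorm_le_of_lintegral_le (hp : 1 ≤ p) {f : α → ℝ} (hf : AEStronglyMeasurable f μ)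
    (h0 : ∀ x, 0 ≤ f x) {ε : ℝ} (hε : 0 ≤ ε)
    (h : ∫⁻ x, ENNReal.ofReal (f x) ^ p ∂μ ≤ ENNReal.ofReal ε ^ p) :
    MemLp f (ENNReal.ofReal p) μ ∧ lpNorm f (ENNReal.ofReal p) μ ≤ ε := by
  have hp0 : 0 < p := by linarith
  have hm := memLp_of_lintegral_ofReal_rpow_lt_top hp hf h0
    (h.trans_lt (ENNReal.rpow_lt_top_of_nonneg hp0.le ENNReal.ofReal_ne_top))
  refine ⟨hm, ?_⟩
  rwa [lintegral_ofReal_rpow_eq hp hm h0, ENNReal.rpow_le_rpow_iff hp0,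
    ENNReal.ofReal_le_ofReal_iff hε] at h

theorem lpNorm_eq_integral_rpow (hp : 1 ≤ p) {f : α → ℝ} (hf : MemLp f (ENNReal.ofReal p) μ)
    (h0 : ∀ x, 0 ≤ f x) :
    lpNorm f (ENNReal.ofReal p) μ = (∫ x, f x ^ p ∂μ) ^ (1 / p) := by
  have hp0 : 0 < p := by linarith
  rw [lpNorm_eq_integral_norm_rpow_toReal (by simpa using hp0) (by simp) hf.1,
    ENNReal.toReal_ofReal hp0.le, one_div]
  simp_rw [Real.norm_of_nonneg (h0 _)]

theorem integrable_rpow_of_memLp (hp : 1 ≤ p) {f : α → ℝ} (hf : MemLp f (ENNReal.ofReal p) μ)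
    (h0 : ∀ x, 0 ≤ f x) : Integrable (fun x => f x ^ p) μ := by
  have hp0 : 0 < p := by linarith
  have := hf.integrable_norm_rpow (by simpa using hp0) (by simp)
  rw [ENNReal.toReal_ofReal hp0.le] at this
  simpa only [Real.norm_of_nonneg (h0 _)] using this

end Lp

/-- `F` admits a coupling with `F₀` whose `p`-th order transport cost is at most `C`. -/
def CoupledWithin {n : ℕ} (nrm : Vec n → ℝ) (p : ℝ) (F₀ : Measure (Vec n)) (C : ℝ≥0∞)
    (F : Measure (Vec n)) : Prop :=
  IsProbabilityMeasure F ∧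
    ∃ π ∈ Couplings F F₀, ∫⁻ z, ENNReal.ofReal (nrm (z.1 - z.2)) ^ p ∂π ≤ C

section Ball

variable {n : ℕ} {nrm : Vec n → ℝ} {p : ℝ} {F F₀ F₁ F₂ : Measure (Vec n)}

theorem hasMomentP_iff_memLp (h : IsNorm nrm) (hp : 1 ≤ p) (μ : Measure (Vec n)) :
    HasMomentP nrm (ENNReal.ofReal p) μ ↔ MemLp nrm (ENNReal.ofReal p) μ := by
  have hp0 : 0 < p := by linarith
  rw [HasMomentP, if_neg ENNReal.ofReal_ne_top, ENNReal.toReal_ofReal hp0.le]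
  refine ⟨fun hm => memLp_of_lintegral_ofReal_rpow_lt_top hp
    h.continuous.measurable.aestronglyMeasurable h.nonneg (lt_top_iff_ne_top.2 hm), fun hm => ?_⟩
  rw [lintegral_ofReal_rpow_eq hp hm h.nonneg]
  exact (ENNReal.rpow_lt_top_of_nonneg hp0.le ENNReal.ofReal_ne_top).ne

theorem IsNorm.measurable_cost (h : IsNorm nrm) :
    Measurable fun z : Vec n × Vec n => nrm (z.1 - z.2) :=
  (h.continuous.comp (continuous_fst.sub continuous_snd)).measurable

theorem CoupledWithin.exists_coupling (h : IsNorm nrm) (hp : 1 ≤ p) {ε : ℝ} (hε : 0 ≤ ε)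
    (hF : CoupledWithin nrm p F₀ (ENNReal.ofReal ε ^ p) F) :
    ∃ π ∈ Couplings F F₀, MemLp (fun z => nrm (z.1 - z.2)) (ENNReal.ofReal p) π ∧
      lpNorm (fun z => nrm (z.1 - z.2)) (ENNReal.ofReal p) π ≤ ε := by
  obtain ⟨-, π, hπ, hc⟩ := hF
  exact ⟨π, hπ, lpNorm_le_of_lintegral_le hp h.measurable_cost.aestronglyMeasurable
    (fun _ => h.nonneg _) hε hc⟩

theorem CoupledWithin.memLp (h : IsNorm nrm) (hp : 1 ≤ p) {ε : ℝ} (hε : 0 ≤ ε)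
    (h₀ : MemLp nrm (ENNReal.ofReal p) F₀)
    (hF : CoupledWithin nrm p F₀ (ENNReal.ofReal ε ^ p) F) : MemLp nrm (ENNReal.ofReal p) F := by
  obtain ⟨π, ⟨_, rfl, rfl⟩, hm, -⟩ := hF.exists_coupling h hp hε
  have hn := h.continuous.measurable
  rw [memLp_map_measure_iff hn.aestronglyMeasurable measurable_snd.aemeasurable] at h₀
  rw [memLp_map_measure_iff hn.aestronglyMeasurable measurable_fst.aemeasurable]
  refine (hm.add h₀).mono' (hn.comp measurable_fst).aestronglyMeasurable (ae_of_all _ fun z => ?_)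
  rw [Function.comp_apply, Real.norm_of_nonneg (h.nonneg _)]
  simpa using h.2.2 (z.1 - z.2) z.2

theorem CoupledWithin.mem_WballVec (h : IsNorm nrm) (hp : 1 ≤ p) {ε : ℝ} (hε : 0 ≤ ε)
    (h₀ : MemLp nrm (ENNReal.ofReal p) F₀)
    (hF : CoupledWithin nrm p F₀ (ENNReal.ofReal ε ^ p) F) :
    F ∈ WballVec nrm (ENNReal.ofReal p) F₀ ε := by
  have hp0 : 0 < p := by linarith
  refine ⟨hF.1, (hasMomentP_iff_memLp h hp F).2 (hF.memLp h hp hε h₀), ?_⟩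
  obtain ⟨-, π, hπ, hc⟩ := hF
  rw [WassersteinD, if_neg ENNReal.ofReal_ne_top, ENNReal.toReal_ofReal hp0.le]
  refine iInf₂_le_of_le π hπ ?_
  rw [one_div, ENNReal.rpow_inv_le_iff hp0]
  exact hc

theorem coupledWithin_of_mem_WballVec (hp : 1 ≤ p) {ε δ : ℝ} (hε : 0 ≤ ε) (hδ : 0 < δ)
    (hF : F ∈ WballVec nrm (ENNReal.ofReal p) F₀ ε) :
    CoupledWithin nrm p F₀ (ENNReal.ofReal (ε + δ) ^ p) F := by
  have hp0 : 0 < p := by linarith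
  obtain ⟨hprob, -, hW⟩ := hF
  rw [WassersteinD, if_neg ENNReal.ofReal_ne_top, ENNReal.toReal_ofReal hp0.le] at hW
  have hlt := hW.trans_lt ((ENNReal.ofReal_lt_ofReal_iff (by linarith : 0 < ε + δ)).2
    (by linarith : ε < ε + δ))
  simp only [iInf_lt_iff] at hlt
  obtain ⟨π, hπ, hc⟩ := hlt
  refine ⟨hprob, π, hπ, ?_⟩
  rw [← ENNReal.rpow_inv_le_iff hp0, ← one_div]
  exact hc.le

theorem isProbabilityMeasure_mix {α : Type*} [MeasurableSpace α] {μ ν : Measure α}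
    [IsProbabilityMeasure μ] [IsProbabilityMeasure ν] {a b : ℝ} (ha : 0 ≤ a) (hb : 0 ≤ b)
    (hab : a + b = 1) : IsProbabilityMeasure (ENNReal.ofReal a • μ + ENNReal.ofReal b • ν) :=
  ⟨by simp [← ENNReal.ofReal_add ha hb, hab]⟩

theorem CoupledWithin.mix {C₁ C₂ : ℝ≥0∞} (h₁ : CoupledWithin nrm p F₀ C₁ F₁)
    (h₂ : CoupledWithin nrm p F₀ C₂ F₂) {a b : ℝ} (ha : 0 ≤ a) (hb : 0 ≤ b) (hab : a + b = 1) :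
    CoupledWithin nrm p F₀ (ENNReal.ofReal a * C₁ + ENNReal.ofReal b * C₂)
      (ENNReal.ofReal a • F₁ + ENNReal.ofReal b • F₂) := by
  obtain ⟨_, π₁, ⟨_, hf₁, hs₁⟩, hc₁⟩ := h₁
  obtain ⟨_, π₂, ⟨_, hf₂, hs₂⟩, hc₂⟩ := h₂
  refine ⟨isProbabilityMeasure_mix ha hb hab, ENNReal.ofReal a • π₁ + ENNReal.ofReal b • π₂,
    ⟨isProbabilityMeasure_mix ha hb hab, ?_, ?_⟩, ?_⟩
  · rw [Measure.map_add _ _ measurable_fst, Measure.map_smul, Measure.map_smul, hf₁, hf₂]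
  · rw [Measure.map_add _ _ measurable_snd, Measure.map_smul, Measure.map_smul, hs₁, hs₂,
      ← add_smul, ← ENNReal.ofReal_add ha hb, hab, ENNReal.ofReal_one, one_smul]
  · rw [lintegral_add_measure, lintegral_smul_measure, lintegral_smul_measure]
    simp only [smul_eq_mul]
    gcongr

theorem CoupledWithin.mono_cost {C₁ C₂ : ℝ≥0∞} (hF : CoupledWithin nrm p F₀ C₁ F)
    (hC : C₁ ≤ C₂) : CoupledWithin nrm p F₀ C₂ F :=
  let ⟨hprob, π, hπ, hc⟩ := hF
  ⟨hprob, π, hπ, hc.trans hC⟩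

theorem coupledWithin_map [IsProbabilityMeasure F₀] (h : IsNorm nrm) {T : Vec n → Vec n}
    (hT : Measurable T) {C : ℝ≥0∞} (hC : ∫⁻ x, ENNReal.ofReal (nrm (T x - x)) ^ p ∂F₀ ≤ C) :
    CoupledWithin nrm p F₀ C (F₀.map T) := by
  have hTi : Measurable fun x => (T x, x) := hT.prodMk measurable_id
  refine ⟨Measure.isProbabilityMeasure_map hT.aemeasurable, F₀.map fun x => (T x, x),
    ⟨Measure.isProbabilityMeasure_map hTi.aemeasurable, ?_, ?_⟩, ?_⟩
  · rw [Measure.map_map measurable_fst hTi]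
    rfl
  · rw [Measure.map_map measurable_snd hTi]
    exact Measure.map_id
  · rwa [lintegral_map (h.measurable_cost.ennreal_ofReal.pow_const p) hTi]

theorem coupledWithin_self [IsProbabilityMeasure F₀] (h : IsNorm nrm) (hp : 1 ≤ p) (C : ℝ≥0∞) :
    CoupledWithin nrm p F₀ C F₀ := by
  have hp0 : 0 < p := by linarith
  have := coupledWithin_map (F₀ := F₀) (p := p) (C := C) h measurable_id
    (by simp [h.map_zero, hp0])
  rwa [Measure.map_id] at this

end Ball

section Lp

variable {α γ : Type*} [MeasurableSpace α] [MeasurableSpace γ] {μ ν : Measure α} {p : ℝ}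

theorem lpNorm_map_measure {P : ℝ≥0∞} {T : α → γ} {f : γ → ℝ} (hf : Measurable f)
    (hT : Measurable T) : lpNorm f P (μ.map T) = lpNorm (f ∘ T) P μ := by
  rw [← toReal_eLpNorm hf.aestronglyMeasurable,
    ← toReal_eLpNorm (hf.comp hT).aestronglyMeasurable,
    eLpNorm_map_measure hf.aestronglyMeasurable hT.aemeasurable]

theorem lpNorm_const_mul {P : ℝ≥0∞} {a : ℝ} (ha : 0 ≤ a) (f : α → ℝ) :
    lpNorm (fun x => a * f x) P μ = a * lpNorm f P μ := by
  have := lpNorm_const_smul (p := P) a f μ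
  rwa [coe_nnnorm, Real.norm_of_nonneg ha] at this

theorem le_lpNorm_add_lpNorm [IsProbabilityMeasure μ] {P : ℝ≥0∞} (hP : 1 ≤ P) {f g : α → ℝ}
    (hf : MemLp f P μ) (hg : MemLp g P μ) (hf0 : ∀ x, 0 ≤ f x) (hg0 : ∀ x, 0 ≤ g x) {r : ℝ}
    (h : ∀ x, r ≤ f x + g x) : r ≤ lpNorm f P μ + lpNorm g P μ := by
  have := lpNorm_le_add_of_abs_le hP (f := fun _ => max r 0) hf hg fun x => by
    rw [abs_of_nonneg (le_max_right _ _)]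
    exact max_le (h x) (add_nonneg (hf0 x) (hg0 x))
  rw [lpNorm_const (by positivity) (IsProbabilityMeasure.ne_zero μ)] at this
  simp only [Real.norm_eq_abs, abs_of_nonneg (le_max_right r 0), probReal_univ, Real.one_rpow,
    mul_one] at this
  exact (le_max_left _ _).trans this

theorem integral_mix {f : α → ℝ} (hμ : Integrable f μ) (hν : Integrable f ν) {a b : ℝ}
    (ha : 0 ≤ a) (hb : 0 ≤ b) :
    ∫ x, f x ∂(ENNReal.ofReal a • μ + ENNReal.ofReal b • ν)
      = a * ∫ x, f x ∂μ + b * ∫ x, f x ∂ν := by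
  rw [integral_add_measure (hμ.smul_measure ENNReal.ofReal_ne_top)
    (hν.smul_measure ENNReal.ofReal_ne_top), integral_smul_measure, integral_smul_measure,
    ENNReal.toReal_ofReal ha, ENNReal.toReal_ofReal hb, smul_eq_mul, smul_eq_mul]

theorem memLp_mix (hp : 1 ≤ p) {f : α → ℝ} (hμ : MemLp f (ENNReal.ofReal p) μ)
    (hν : MemLp f (ENNReal.ofReal p) ν) (a b : ℝ) :
    MemLp f (ENNReal.ofReal p) (ENNReal.ofReal a • μ + ENNReal.ofReal b • ν) := by
  have hp0 : 0 < p := by linarith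
  have h0 : ENNReal.ofReal p ≠ 0 := by simpa using hp0
  have hmeas := (hμ.1.smul_measure (ENNReal.ofReal a)).add_measure
    (hν.1.smul_measure (ENNReal.ofReal b))
  rw [← integrable_norm_rpow_iff hmeas h0 ENNReal.ofReal_ne_top]
  exact ((hμ.integrable_norm_rpow h0 ENNReal.ofReal_ne_top).smul_measure
    ENNReal.ofReal_ne_top).add_measure
    ((hν.integrable_norm_rpow h0 ENNReal.ofReal_ne_top).smul_measure ENNReal.ofReal_ne_top)

theorem lpNorm_mix_ge (hp : 1 ≤ p) {f : α → ℝ} (hμ : MemLp f (ENNReal.ofReal p) μ)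
    (hν : MemLp f (ENNReal.ofReal p) ν) (h0 : ∀ x, 0 ≤ f x) {a b : ℝ} (ha : 0 ≤ a) (hb : 0 ≤ b)
    (hab : a + b = 1) :
    a * lpNorm f (ENNReal.ofReal p) μ + b * lpNorm f (ENNReal.ofReal p) ν
      ≤ lpNorm f (ENNReal.ofReal p) (ENNReal.ofReal a • μ + ENNReal.ofReal b • ν) := by
  have hp0 : 0 < p := by linarith
  rw [lpNorm_eq_integral_rpow hp hμ h0, lpNorm_eq_integral_rpow hp hν h0,
    lpNorm_eq_integral_rpow hp (memLp_mix hp hμ hν a b) h0,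
    integral_mix (integrable_rpow_of_memLp hp hμ h0) (integrable_rpow_of_memLp hp hν h0) ha hb]
  exact (Real.concaveOn_rpow (by positivity) ((div_le_one hp0).2 hp)).2
    (mem_Ici.2 (integral_nonneg fun x => Real.rpow_nonneg (h0 x) p))
    (mem_Ici.2 (integral_nonneg fun x => Real.rpow_nonneg (h0 x) p)) ha hb hab

theorem mul_lpNorm_le_lpNorm_mix (hp : 1 ≤ p) {f : α → ℝ} (hμ : MemLp f (ENNReal.ofReal p) μ)
    (hν : MemLp f (ENNReal.ofReal p) ν) (h0 : ∀ x, 0 ≤ f x) {a τ : ℝ} (ha : 0 ≤ a) (hτ : 0 ≤ τ) :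
    τ * lpNorm f (ENNReal.ofReal p) ν
      ≤ lpNorm f (ENNReal.ofReal p) (ENNReal.ofReal a • μ + ENNReal.ofReal (τ ^ p) • ν) := by
  have hp0 : 0 < p := by linarith
  have hI : ∀ μ : Measure α, 0 ≤ ∫ x, f x ^ p ∂μ :=
    fun μ => integral_nonneg fun x => Real.rpow_nonneg (h0 x) p
  have hτp := Real.rpow_nonneg hτ p
  rw [lpNorm_eq_integral_rpow hp hν h0, lpNorm_eq_integral_rpow hp (memLp_mix hp hμ hν _ _) h0,
    integral_mix (integrable_rpow_of_memLp hp hμ h0) (integrable_rpow_of_memLp hp hν h0) ha hτp]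
  calc τ * (∫ x, f x ^ p ∂ν) ^ (1 / p) = (τ ^ p * ∫ x, f x ^ p ∂ν) ^ (1 / p) := by
        rw [Real.mul_rpow hτp (hI ν), ← Real.rpow_mul hτ, mul_one_div_cancel hp0.ne',
          Real.rpow_one]
    _ ≤ _ := Real.rpow_le_rpow (mul_nonneg hτp (hI ν))
        (le_add_of_nonneg_left (mul_nonneg ha (hI μ))) (by positivity)

end Lp

/-- The `L^p(F)`-norm of the loss `ℓ(β^⊤Z, t)`. -/
def lossNorm {n : ℕ} (ℓ : ℝ → ℝ → ℝ) (p : ℝ) (β : Vec n) (F : Measure (Vec n)) (t : ℝ) : ℝ :=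
  lpNorm (fun x => ℓ (dotp β x) t) (ENNReal.ofReal p) F

section Loss

variable {n : ℕ} {nrm : Vec n → ℝ} {p c : ℝ} {ℓ : ℝ → ℝ → ℝ} {F F₀ : Measure (Vec n)}

theorem lossNorm_nonneg (β : Vec n) (t : ℝ) : 0 ≤ lossNorm ℓ p β F t := lpNorm_nonneg

theorem IsLoss.continuous_left (hℓ : IsLoss c ℓ) (t : ℝ) : Continuous fun z => ℓ z t := by
  refine (LipschitzWith.of_dist_le_mul (K := c.toNNReal) fun z z' => ?_).continuous
  rw [Real.dist_eq, Real.dist_eq]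
  refine (hℓ.lip_left z z' t).trans ?_
  gcongr
  exact Real.le_coe_toNNReal c

theorem IsLoss.continuous_comp (hℓ : IsLoss c ℓ) (β : Vec n) (t : ℝ) :
    Continuous fun x => ℓ (dotp β x) t :=
  (hℓ.continuous_left t).comp (continuous_dotp β)

theorem IsNorm.memLp_abs_dotp (h : IsNorm nrm) {P : ℝ≥0∞} (hF : MemLp nrm P F) (β : Vec n) :
    MemLp (fun x => |dotp β x|) P F :=
  (hF.const_mul (dualNorm nrm β)).mono' (continuous_dotp β).abs.aestronglyMeasurable
    (ae_of_all _ fun x => by simpa using h.abs_dotp_le β x)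

theorem IsLoss.memLp (hℓ : IsLoss c ℓ) (h : IsNorm nrm) [IsProbabilityMeasure F] {P : ℝ≥0∞}
    (hF : MemLp nrm P F) (β : Vec n) (t : ℝ) : MemLp (fun x => ℓ (dotp β x) t) P F := by
  refine ((memLp_const (ℓ 0 t)).add ((h.memLp_abs_dotp hF β).const_mul c)).mono'
    (hℓ.continuous_comp β t).aestronglyMeasurable (ae_of_all _ fun x => ?_)
  rw [Real.norm_of_nonneg (hℓ.nonneg _ _)]
  have := (abs_sub_le_iff.1 (hℓ.lip_left (dotp β x) 0 t)).1
  rw [sub_zero] at this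
  simp only [Pi.add_apply]
  linarith

theorem IsLoss.rhoInfT_eq (hℓ : IsLoss c ℓ) (h : IsNorm nrm) (hp : 1 ≤ p) [IsProbabilityMeasure F]
    (hF : MemLp nrm (ENNReal.ofReal p) F) (β : Vec n) :
    rhoInfT ℓ p F β = ⨅ t, (t + lossNorm ℓ p β F t) := by
  simp only [rhoInfT, iInf, lossNorm]
  congr 1
  ext r
  simp only [mem_ofPred_eq, mem_range]
  refine exists_congr fun t => ?_
  rw [lpNorm_eq_integral_rpow hp (hℓ.memLp h hF β t) fun x => hℓ.nonneg _ _, eq_comm]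

theorem IsLoss.lossNorm_sub_le (hℓ : IsLoss c ℓ) (hc : 0 ≤ c) (h : IsNorm nrm) (hp : 1 ≤ p) {ε : ℝ}
    (hε : 0 ≤ ε) (h₀ : MemLp nrm (ENNReal.ofReal p) F₀) [IsProbabilityMeasure F₀]
    (hF : CoupledWithin nrm p F₀ (ENNReal.ofReal ε ^ p) F) (β : Vec n) (t : ℝ) :
    |lossNorm ℓ p β F t - lossNorm ℓ p β F₀ t| ≤ c * ε * dualNorm nrm β := by
  have := hF.1
  have hm := hℓ.memLp h (hF.memLp h hp hε h₀) β t
  have hm₀ := hℓ.memLp h h₀ β t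
  obtain ⟨π, ⟨_, hfst, hsnd⟩, hmc, hle⟩ := hF.exists_coupling h hp hε
  have hmeas := (hℓ.continuous_comp β t).measurable
  have hd := mul_nonneg hc (h.dualNorm_nonneg β)
  have hP : 1 ≤ ENNReal.ofReal p := by simpa using hp
  have hk := hmc.const_mul (c * dualNorm nrm β)
  have hbound : lpNorm (fun z => c * dualNorm nrm β * nrm (z.1 - z.2)) (ENNReal.ofReal p) π
      ≤ c * ε * dualNorm nrm β := by
    rw [lpNorm_const_mul hd]
    nlinarith
  have hlip : ∀ z : Vec n × Vec n, |ℓ (dotp β z.1) t - ℓ (dotp β z.2) t|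
      ≤ c * dualNorm nrm β * nrm (z.1 - z.2) := fun z => by
    refine (hℓ.lip_left _ _ t).trans ?_
    rw [← dotp_sub, mul_assoc]
    exact mul_le_mul_of_nonneg_left (h.abs_dotp_le β _) hc
  rw [← hfst, memLp_map_measure_iff hmeas.aestronglyMeasurable measurable_fst.aemeasurable] at hm
  rw [← hsnd, memLp_map_measure_iff hmeas.aestronglyMeasurable measurable_snd.aemeasurable] at hm₀
  have e : lossNorm ℓ p β F t = lpNorm (fun z => ℓ (dotp β z.1) t) (ENNReal.ofReal p) π := by
    rw [lossNorm, ← hfst, lpNorm_map_measure hmeas measurable_fst]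
    rfl
  have e₀ : lossNorm ℓ p β F₀ t = lpNorm (fun z => ℓ (dotp β z.2) t) (ENNReal.ofReal p) π := by
    rw [lossNorm, ← hsnd, lpNorm_map_measure hmeas measurable_snd]
    rfl
  rw [e, e₀, abs_sub_le_iff]
  constructor
  · have := lpNorm_le_add_of_abs_le hP (f := fun z : Vec n × Vec n => ℓ (dotp β z.1) t) hm₀ hk
      fun z => by
        rw [abs_of_nonneg (hℓ.nonneg _ _), Function.comp_apply]
        linarith [(abs_sub_le_iff.1 (hlip z)).1]
    simp only [Function.comp_def] at this
    linarith
  · have := lpNorm_le_add_of_abs_le hP (f := fun z : Vec n × Vec n => ℓ (dotp β z.2) t) hm hk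
      fun z => by
        rw [abs_of_nonneg (hℓ.nonneg _ _), Function.comp_apply]
        linarith [(abs_sub_le_iff.1 (hlip z)).2]
    simp only [Function.comp_def] at this
    linarith

theorem IsLoss.continuous_lossNorm (hℓ : IsLoss c ℓ) (h : IsNorm nrm) (hp : 1 ≤ p)
    [IsProbabilityMeasure F] (hF : MemLp nrm (ENNReal.ofReal p) F) (β : Vec n) :
    Continuous (lossNorm ℓ p β F) := by
  have hP : 1 ≤ ENNReal.ofReal p := by simpa using hp
  have key : ∀ t t', lossNorm ℓ p β F t ≤ lossNorm ℓ p β F t' + c.toNNReal * |t - t'| := by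
    intro t t'
    have := lpNorm_le_add_of_abs_le hP (f := fun x => ℓ (dotp β x) t) (hℓ.memLp h hF β t')
      (memLp_const (c.toNNReal * |t - t'|)) fun x => by
        rw [abs_of_nonneg (hℓ.nonneg _ _)]
        have h1 := (abs_sub_le_iff.1 (hℓ.lip_right (dotp β x) t t')).1
        have h2 := mul_le_mul_of_nonneg_right (Real.le_coe_toNNReal c) (abs_nonneg (t - t'))
        linarith
    rw [lpNorm_const (by positivity) (IsProbabilityMeasure.ne_zero F)] at this
    simpa [lossNorm, abs_of_nonneg (le_max_right c 0)] using this
  refine (LipschitzWith.of_dist_le_mul (K := c.toNNReal) fun t t' => ?_).continuous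
  rw [Real.dist_eq, Real.dist_eq, abs_sub_le_iff]
  have h1 := key t t'
  have h2 := key t' t
  rw [abs_sub_comm] at h2
  constructor <;> linarith

theorem IsLoss.convexOn_lossNorm (hℓ : IsLoss c ℓ) (h : IsNorm nrm) (hp : 1 ≤ p)
    [IsProbabilityMeasure F] (hF : MemLp nrm (ENNReal.ofReal p) F) (β : Vec n) :
    ConvexOn ℝ univ (lossNorm ℓ p β F) := by
  have hP : 1 ≤ ENNReal.ofReal p := by simpa using hp
  refine ⟨convex_univ, fun t _ t' _ a b ha hb hab => ?_⟩
  have := lpNorm_le_add_of_abs_le hP (f := fun x => ℓ (dotp β x) (a • t + b • t'))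
    ((hℓ.memLp h hF β t).const_mul a) ((hℓ.memLp h hF β t').const_mul b) fun x => by
      rw [abs_of_nonneg (hℓ.nonneg _ _)]
      exact (hℓ.convex (dotp β x)).2 (mem_univ t) (mem_univ t') ha hb hab
  rwa [lpNorm_const_mul ha, lpNorm_const_mul hb] at this

theorem IsLoss.exists_coercive (hℓ : IsLoss c ℓ) (hc : 0 ≤ c) (h : IsNorm nrm) (hp : 1 ≤ p)
    [IsProbabilityMeasure F] (hF : MemLp nrm (ENNReal.ofReal p) F) (β : Vec n) :
    ∃ K, ∀ t, c * -t - K ≤ lossNorm ℓ p β F t := by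
  have hP : 1 ≤ ENNReal.ofReal p := by simpa using hp
  obtain ⟨K, hK⟩ := hℓ.coercive
  refine ⟨c * K + c * lpNorm (fun x => |dotp β x|) (ENNReal.ofReal p) F, fun t => ?_⟩
  have := le_lpNorm_add_lpNorm hP (hℓ.memLp h hF β t) ((h.memLp_abs_dotp hF β).const_mul c)
    (fun x => hℓ.nonneg _ _) (fun x => mul_nonneg hc (abs_nonneg _)) fun x => hK (dotp β x) t
  rw [lpNorm_const_mul hc] at this
  rw [lossNorm]
  linarith

theorem IsLoss.bddBelow_range (hℓ : IsLoss c ℓ) (hc : 1 < c) (h : IsNorm nrm) (hp : 1 ≤ p)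
    [IsProbabilityMeasure F] (hF : MemLp nrm (ENNReal.ofReal p) F) (β : Vec n) :
    BddBelow (range fun t => t + lossNorm ℓ p β F t) := by
  obtain ⟨K, hK⟩ := hℓ.exists_coercive (by linarith) h hp hF β
  refine ⟨-|K|, ?_⟩
  rintro _ ⟨t, rfl⟩
  have h1 := lossNorm_nonneg (ℓ := ℓ) (p := p) (F := F) β t
  have h2 := hK t
  simp only
  rcases le_total 0 t with ht | ht
  · linarith [abs_nonneg K]
  · nlinarith [le_abs_self K]

end Loss

section WorstCase

variable {n : ℕ} {nrm : Vec n → ℝ} {p c ε : ℝ} {ℓ : ℝ → ℝ → ℝ} {F F₀ : Measure (Vec n)}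

theorem IsLoss.exists_lossNorm_ge_of_pos (hℓ : IsLoss c ℓ) (hc : 0 ≤ c) (h : IsNorm nrm)
    (hp : 1 ≤ p) (hε : 0 ≤ ε) [IsProbabilityMeasure F₀] (h₀ : MemLp nrm (ENNReal.ofReal p) F₀)
    (β : Vec n) {t : ℝ} (hA : 0 < lossNorm ℓ p β F₀ t) :
    ∃ F, CoupledWithin nrm p F₀ (ENNReal.ofReal ε ^ p) F ∧
      lossNorm ℓ p β F₀ t + c * ε * dualNorm nrm β ≤ lossNorm ℓ p β F t := by
  have hp0 : 0 ≤ p := by linarith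
  obtain ⟨u, hu, hud, -⟩ := h.exists_dualNorm_eq β
  obtain ⟨s, hs, hs1, hal⟩ := hℓ.aligned t
  have hd := h.dualNorm_nonneg β
  set A := lossNorm ℓ p β F₀ t with hAdef
  have hr : 0 ≤ ε / A := div_nonneg hε hA.le
  have hmeas := (hℓ.continuous_comp β t).measurable
  have hdot := (continuous_dotp β).measurable
  have hm := hℓ.memLp h h₀ β t
  let T : Vec n → Vec n := fun x => x + (s (dotp β x) * (ε / A * ℓ (dotp β x) t)) • u
  have hT : Measurable T :=
    measurable_id.add (((hs.comp hdot).mul (hmeas.const_mul (ε / A))).smul_const u)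
  have hcost : ∀ x, nrm (T x - x) ≤ ε / A * ℓ (dotp β x) t := fun x => by
    have hv := mul_nonneg hr (hℓ.nonneg (dotp β x) t)
    simp only [T, add_sub_cancel_left]
    rw [h.2.1, abs_mul, abs_of_nonneg hv]
    calc |s (dotp β x)| * (ε / A * ℓ (dotp β x) t) * nrm u
        ≤ 1 * (ε / A * ℓ (dotp β x) t) * 1 := by
          gcongr
          · exact h.nonneg u
          · exact hs1 _
      _ = _ := by ring
  have hF : CoupledWithin nrm p F₀ (ENNReal.ofReal ε ^ p) (F₀.map T) := by
    refine coupledWithin_map h hT ?_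
    calc ∫⁻ x, ENNReal.ofReal (nrm (T x - x)) ^ p ∂F₀
        ≤ ∫⁻ x, ENNReal.ofReal (ε / A * ℓ (dotp β x) t) ^ p ∂F₀ :=
          lintegral_mono fun x => ENNReal.rpow_le_rpow (ENNReal.ofReal_le_ofReal (hcost x)) hp0
      _ = ENNReal.ofReal ε ^ p := by
          rw [lintegral_ofReal_rpow_eq hp (hm.const_mul _)
            fun x => mul_nonneg hr (hℓ.nonneg _ _), lpNorm_const_mul hr]
          change ENNReal.ofReal (ε / A * A) ^ p = _
          rw [div_mul_cancel₀ _ hA.ne']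
  refine ⟨_, hF, ?_⟩
  have := hF.1
  have hmF := hℓ.memLp h (hF.memLp h hp hε h₀) β t
  rw [memLp_map_measure_iff hmeas.aestronglyMeasurable hT.aemeasurable] at hmF
  have hk : 0 ≤ c * (ε / A * dualNorm nrm β) := mul_nonneg hc (mul_nonneg hr hd)
  have key := lpNorm_mono_real
    (f := fun x => (1 + c * (ε / A * dualNorm nrm β)) * ℓ (dotp β x) t) hmF fun x => by
      have hv := hal (dotp β x) (ε / A * ℓ (dotp β x) t * dualNorm nrm β)
        (mul_nonneg (mul_nonneg hr (hℓ.nonneg _ _)) hd) fun h0 => by simp [h0]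
      rw [Real.norm_of_nonneg (mul_nonneg (by linarith) (hℓ.nonneg _ _)), Function.comp_apply]
      simp only [T, dotp_add, dotp_smul, hud]
      rw [mul_assoc (s _)]
      linarith
  rw [lpNorm_const_mul (by linarith)] at key
  rw [lossNorm, lpNorm_map_measure hmeas hT]
  refine le_trans (le_of_eq ?_) key
  change _ = _ * A
  field_simp

theorem IsLoss.exists_lt_lossNorm_of_eq_zero (hℓ : IsLoss c ℓ) (hc : 0 ≤ c) (h : IsNorm nrm)
    (hp : 1 ≤ p) (hε : 0 ≤ ε) [IsProbabilityMeasure F₀] (h₀ : MemLp nrm (ENNReal.ofReal p) F₀)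
    (β : Vec n) (t : ℝ) {v : ℝ} (hv : v < c * ε * dualNorm nrm β) :
    ∃ F, CoupledWithin nrm p F₀ (ENNReal.ofReal ε ^ p) F ∧ v < lossNorm ℓ p β F t := by
  have hp0 : 0 < p := by linarith
  have hP : 1 ≤ ENNReal.ofReal p := by simpa using hp
  obtain ⟨u, hu, hud, -⟩ := h.exists_dualNorm_eq β
  obtain ⟨K, hK⟩ := hℓ.growth
  set C := c * (|t| + K) + c * lpNorm (fun x => |dotp β x|) (ENNReal.ofReal p) F₀
  obtain ⟨τ, hτ, hτ1, hτC⟩ : ∃ τ > 0, τ ≤ 1 ∧ v < c * ε * dualNorm nrm β - τ * C := by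
    have hlim : Filter.Tendsto (fun τ : ℝ => c * ε * dualNorm nrm β - τ * C)
        (nhdsWithin 0 (Ioi 0)) (nhds (c * ε * dualNorm nrm β - 0 * C)) :=
      (Continuous.tendsto (by fun_prop) 0).mono_left nhdsWithin_le_nhds
    rw [zero_mul, sub_zero] at hlim
    obtain ⟨τ, hτv, hτ0, hτ1⟩ := ((hlim.eventually_const_lt hv).and
      (Ioc_mem_nhdsGT (zero_lt_one' ℝ))).exists
    exact ⟨τ, hτ0, hτ1, hτv⟩
  have hτp := Real.rpow_nonneg hτ.le p
  have hτp1 : 0 ≤ 1 - τ ^ p := sub_nonneg.2 (Real.rpow_le_one hτ.le hτ1 hp0.le)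
  have hετ : 0 ≤ ε / τ := div_nonneg hε hτ.le
  have hT : Measurable fun x : Vec n => x + (ε / τ) • u := measurable_id.add_const _
  have hshift : CoupledWithin nrm p F₀ (ENNReal.ofReal (ε / τ) ^ p)
      (F₀.map fun x => x + (ε / τ) • u) := by
    refine coupledWithin_map h hT ?_
    simp only [add_sub_cancel_left, lintegral_const, measure_univ, mul_one]
    refine ENNReal.rpow_le_rpow (ENNReal.ofReal_le_ofReal ?_) hp0.le
    rw [h.2.1, abs_of_nonneg hετ]
    exact mul_le_of_le_one_right hετ hu
  have hmix := (coupledWithin_self (F₀ := F₀) h hp 0).mix hshift hτp1 hτp (by ring)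
  have hcost : ENNReal.ofReal (1 - τ ^ p) * 0 + ENNReal.ofReal (τ ^ p) * ENNReal.ofReal (ε / τ) ^ p
      = ENNReal.ofReal ε ^ p := by
    rw [mul_zero, zero_add, ENNReal.ofReal_rpow_of_nonneg hετ hp0.le, ← ENNReal.ofReal_mul hτp,
      ← Real.mul_rpow hτ.le hετ, mul_div_cancel₀ _ hτ.ne', ENNReal.ofReal_rpow_of_nonneg hε hp0.le]
  rw [hcost] at hmix
  refine ⟨_, hmix, hτC.trans_le ?_⟩
  have := hshift.1
  have hm₁ := hℓ.memLp h (hshift.memLp h hp hετ h₀) β t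
  refine le_trans ?_ (mul_lpNorm_le_lpNorm_mix hp (hℓ.memLp h h₀ β t) hm₁
    (fun x => hℓ.nonneg _ _) hτp1 hτ.le)
  have hmeas := (hℓ.continuous_comp β t).measurable
  rw [memLp_map_measure_iff hmeas.aestronglyMeasurable hT.aemeasurable] at hm₁
  have key := le_lpNorm_add_lpNorm hP hm₁ ((h.memLp_abs_dotp h₀ β).const_mul c)
    (fun x => hℓ.nonneg _ _) (fun x => mul_nonneg hc (abs_nonneg _))
    (r := c * (ε / τ * dualNorm nrm β - |t| - K)) fun x => by
      rw [Function.comp_apply, dotp_add, dotp_smul, hud]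
      exact hK _ _ _
  rw [lpNorm_const_mul hc, ← lpNorm_map_measure hmeas hT] at key
  have e : τ * (ε / τ) = ε := mul_div_cancel₀ _ hτ.ne'
  calc c * ε * dualNorm nrm β - τ * C = τ * (c * (ε / τ * dualNorm nrm β - |t| - K)
        - c * lpNorm (fun x => |dotp β x|) (ENNReal.ofReal p) F₀) := by
        simp only [C]
        linear_combination (-(c * dualNorm nrm β)) * e
    _ ≤ _ := mul_le_mul_of_nonneg_left (by linarith) hτ.le

theorem IsLoss.exists_lt_lossNorm (hℓ : IsLoss c ℓ) (hc : 0 ≤ c) (h : IsNorm nrm)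
    (hp : 1 ≤ p) (hε : 0 ≤ ε) [IsProbabilityMeasure F₀] (h₀ : MemLp nrm (ENNReal.ofReal p) F₀)
    (β : Vec n) (t : ℝ) {v : ℝ} (hv : v < lossNorm ℓ p β F₀ t + c * ε * dualNorm nrm β) :
    ∃ F, CoupledWithin nrm p F₀ (ENNReal.ofReal ε ^ p) F ∧ v < lossNorm ℓ p β F t := by
  rcases (lossNorm_nonneg (ℓ := ℓ) (p := p) (F := F₀) β t).eq_or_lt with h0 | hpos
  · rw [← h0, zero_add] at hv
    exact hℓ.exists_lt_lossNorm_of_eq_zero hc h hp hε h₀ β t hv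
  · obtain ⟨F, hF, hle⟩ := hℓ.exists_lossNorm_ge_of_pos hc h hp hε h₀ β hpos
    exact ⟨F, hF, hv.trans_le hle⟩

theorem IsLoss.exists_le_rhoInfT (hℓ : IsLoss c ℓ) (hc : 1 < c) (h : IsNorm nrm)
    (hp : 1 ≤ p) (hε : 0 ≤ ε) [IsProbabilityMeasure F₀] (h₀ : MemLp nrm (ENNReal.ofReal p) F₀)
    (β : Vec n) {v : ℝ} (hv : v < rhoInfT ℓ p F₀ β + c * ε * dualNorm nrm β) :
    ∃ F, CoupledWithin nrm p F₀ (ENNReal.ofReal ε ^ p) F ∧ v ≤ rhoInfT ℓ p F β := by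
  have hc0 : 0 ≤ c := by linarith
  obtain ⟨v', hvv', hv'⟩ := exists_between hv
  rw [hℓ.rhoInfT_eq h hp h₀] at hv'
  obtain ⟨K, hK⟩ := hℓ.exists_coercive hc0 h hp h₀ β
  set B := K + c * ε * dualNorm nrm β
  obtain ⟨R, hR0, hRv, hRB⟩ : ∃ R, 0 ≤ R ∧ v ≤ R ∧ v + B ≤ (c - 1) * R := by
    refine ⟨max (max v 0) ((v + B) / (c - 1)), le_max_of_le_left (le_max_right _ _),
      le_max_of_le_left (le_max_left _ _), ?_⟩
    rw [mul_comm, ← div_le_iff₀ (by linarith)]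
    exact le_max_right _ _
  let ι := {F // CoupledWithin nrm p F₀ (ENNReal.ofReal ε ^ p) F}
  have hprob : ∀ F : ι, IsProbabilityMeasure F.1 := fun F => F.2.1
  have hmem : ∀ F : ι, MemLp nrm (ENNReal.ofReal p) F.1 := fun F => F.2.memLp h hp hε h₀
  obtain ⟨⟨F, hF⟩, hlt⟩ := exists_forall_lt_of_concavelike
    (J := fun (F : ι) t => t + lossNorm ℓ p β F.1 t) (K := Icc (-R) R)
    (fun F => (convexOn_id convex_univ).add (hℓ.convexOn_lossNorm h hp (hmem F) β))
    (fun F => continuous_id.add (hℓ.continuous_lossNorm h hp (hmem F) β))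
    (fun F G a b ha hb hab => by
      refine ⟨⟨_, (F.2.mix G.2 ha hb hab).mono_cost ?_⟩, fun t => ?_⟩
      · rw [← add_mul, ← ENNReal.ofReal_add ha hb, hab, ENNReal.ofReal_one, one_mul]
      · have := lpNorm_mix_ge hp (hℓ.memLp h (hmem F) β t) (hℓ.memLp h (hmem G) β t)
          (fun x => hℓ.nonneg _ _) ha hb hab
        simp only [lossNorm]
        linear_combination this + t * hab)
    (nonempty_Icc.2 (by linarith)) (convex_Icc _ _) isCompact_Icc hvv'
    (fun t _ => by
      have := hv'.trans_le (add_le_add_left (ciInf_le (hℓ.bddBelow_range hc h hp h₀ β) t) _)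
      obtain ⟨F, hF, hlt⟩ := hℓ.exists_lt_lossNorm hc0 h hp hε h₀ β t
        (v := v' - t) (by linarith)
      exact ⟨⟨F, hF⟩, by simp only; linarith⟩)
  refine ⟨F, hF, ?_⟩
  have := hF.1
  rw [hℓ.rhoInfT_eq h hp (hF.memLp h hp hε h₀)]
  refine le_ciInf fun t => ?_
  have hN := lossNorm_nonneg (ℓ := ℓ) (p := p) (F := F) β t
  have hdev := (abs_sub_le_iff.1 (hℓ.lossNorm_sub_le hc0 h hp hε h₀ hF β t)).2
  by_cases ht : t ∈ Icc (-R) R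
  · exact (hlt t ht).le
  · rcases lt_or_ge R t with hRt | hRt
    · linarith
    · have htR : t < -R := by
        by_contra! hge
        exact ht ⟨hge, hRt⟩
      have := hK t
      nlinarith

theorem IsLoss.rhoInfT_le (hℓ : IsLoss c ℓ) (hc : 1 < c) (h : IsNorm nrm)
    (hp : 1 ≤ p) (hε : 0 ≤ ε) [IsProbabilityMeasure F₀] (h₀ : MemLp nrm (ENNReal.ofReal p) F₀)
    (hF : F ∈ WballVec nrm (ENNReal.ofReal p) F₀ ε) (β : Vec n) :
    rhoInfT ℓ p F β ≤ rhoInfT ℓ p F₀ β + c * ε * dualNorm nrm β := by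
  have := hF.1
  have hm := (hasMomentP_iff_memLp h hp F).1 hF.2.1
  have hdev : ∀ t, lossNorm ℓ p β F t ≤ lossNorm ℓ p β F₀ t + c * ε * dualNorm nrm β := by
    intro t
    refine ge_of_tendsto (x := nhdsWithin 0 (Ioi 0))
      (f := fun δ => lossNorm ℓ p β F₀ t + c * (ε + δ) * dualNorm nrm β) ?_ ?_
    · have hcont : Continuous fun δ : ℝ =>
          lossNorm ℓ p β F₀ t + c * (ε + δ) * dualNorm nrm β := by fun_prop
      simpa using (hcont.tendsto 0).mono_left nhdsWithin_le_nhds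
    · filter_upwards [self_mem_nhdsWithin] with δ (hδ : 0 < δ)
      have := (abs_sub_le_iff.1 (hℓ.lossNorm_sub_le (by linarith) h hp (by linarith) h₀
        (coupledWithin_of_mem_WballVec hp hε hδ hF) β t)).1
      linarith
  rw [hℓ.rhoInfT_eq h hp hm, hℓ.rhoInfT_eq h hp h₀, ← sub_le_iff_le_add]
  refine le_ciInf fun t => ?_
  have := ciInf_le (hℓ.bddBelow_range hc h hp hm β) t
  linarith [hdev t]

theorem IsLoss.sSup_rhoInfT_eq (hℓ : IsLoss c ℓ) (hc : 1 < c) (h : IsNorm nrm)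
    (hp : 1 ≤ p) (hε : 0 ≤ ε) [IsProbabilityMeasure F₀] (h₀ : MemLp nrm (ENNReal.ofReal p) F₀)
    (β : Vec n) :
    sSup {s | ∃ F ∈ WballVec nrm (ENNReal.ofReal p) F₀ ε, s = rhoInfT ℓ p F β}
      = rhoInfT ℓ p F₀ β + c * ε * dualNorm nrm β := by
  refine csSup_eq_of_forall_le_of_forall_lt_exists_gt
    ⟨_, F₀, (coupledWithin_self h hp _).mem_WballVec h hp hε h₀, rfl⟩ ?_ fun w hw => ?_
  · rintro _ ⟨F, hF, rfl⟩
    exact hℓ.rhoInfT_le hc h hp hε h₀ hF β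
  · obtain ⟨v, hwv, hv⟩ := exists_between hw
    obtain ⟨F, hF, hle⟩ := hℓ.exists_le_rhoInfT hc h hp hε h₀ β hv
    exact ⟨_, ⟨F, hF.mem_WballVec h hp hε h₀, rfl⟩, hwv.trans_le hle⟩

end WorstCase

/-- Corollary 1 of the paper: exact regularization for risk measures of
the form `ρ^F(Z) = inf_t { t + (E^F[ℓ(Z,t)^p])^{1/p} }`, where `ℓ(z,t) = c·ℓ̄(z-t)` for
`ℓ̄ = ℓ₁, ℓ₃, ℓ₄`, or `ℓ(z,t) = c(|z|-t)₊`. -/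
theorem stmt14 {n : ℕ} (nrm : Vec n → ℝ) (hnrm : IsNorm nrm)
    (p : ℝ) (hp : 1 ≤ p) (c : ℝ) (hc : 1 < c)
    (ℓ : ℝ → ℝ → ℝ)
    (hℓ : (∃ ℓ' : ℝ → ℝ,
        ((∃ m : ℝ, ℓ' = fun x => max (x - m) 0) ∨
         (∃ m₁ m₂ : ℝ, 0 ≤ m₂ ∧ ℓ' = fun x => max (|x - m₁| - m₂) 0) ∨
         (∃ m b : ℝ, 0 < b ∧ ℓ' = fun x => |x - m| + b)) ∧
        ℓ = fun z t => c * ℓ' (z - t)) ∨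
      ℓ = fun z t => c * max (|z| - t) 0)
    (F₀ : Measure (Vec n)) (hF₀ : IsProbabilityMeasure F₀)
    (hmom : HasMomentP nrm (ENNReal.ofReal p) F₀)
    (ε : ℝ) (hε : 0 ≤ ε) (D : Set (Vec n)) :
    sInf {r | ∃ β ∈ D, r =
        sSup {s | ∃ F ∈ WballVec nrm (ENNReal.ofReal p) F₀ ε, s = rhoInfT ℓ p F β}}
      = sInf {r | ∃ β ∈ D, r = rhoInfT ℓ p F₀ β + c * ε * dualNorm nrm β} := by
  have hc0 : 0 ≤ c := by linarith
  have hloss : IsLoss c ℓ := by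
    rcases hℓ with ⟨_, ⟨m, rfl⟩ | ⟨m₁, m₂, -, rfl⟩ | ⟨m, b, hb, rfl⟩, rfl⟩ | rfl
    · exact isLoss_posPart hc0 m
    · exact isLoss_absPosPart hc0 m₁ m₂
    · exact isLoss_absAdd hc0 m hb.le
    · exact isLoss_abs_sub hc0
  have h₀ := (hasMomentP_iff_memLp hnrm hp F₀).1 hmom
  simp only [hloss.sSup_rhoInfT_eq hc hnrm hp hε h₀]
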